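/- arXiv:1409.5571 — 2 statements merged into one kernel-verified Lean document; each statement's English description precedes it below -/
import Mathlib

section
/- Let A be a complex *-algebra and Δ : A → A a 2-local inner derivation. If λ₁e₁ + ⋯ + λ_m e_m and μ₁f₁ + ⋯ + μ_k f_k are linear combinations of two families of pairwise orthogonal projections, all projections lying in a common commutative *-subalgebra of A, then Δ((Σλᵢeᵢ) + (Σμⱼfⱼ)) = Δ(Σλᵢeᵢ) + Δ(Σμⱼfⱼ). -/
/-- Explicit formula for a 2-local inner derivation on the span of a complete orthogonal family. -/
theorem aux_formula {A : Type*} [Ring A] [Algebra ℂ A] (Δ : A → A)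
    (hΔ : ∀ x y : A, ∃ a : A, Δ x = a * x - x * a ∧ Δ y = a * y - y * a)
    {ι : Type*} [Fintype ι] (p : ι → A)
    (hid : ∀ i, p i * p i = p i) (horth : ∀ i j, i ≠ j → p i * p j = 0)
    (hsum : ∑ i, p i = 1) (c : ι → ℂ) :
    Δ (∑ i, c i • p i) = ∑ i, ∑ j, (c i - c j) • (p i * Δ (p i) * p j) := by
  classical
  set x := ∑ i, c i • p i with hx
  have hl : ∀ i, p i * x = c i • p i := by
    intro i
    rw [hx, Finset.mul_sum, Finset.sum_eq_single i]
    · rw [mul_smul_comm, hid]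
    · intro j _ hj
      rw [mul_smul_comm, horth i j (Ne.symm hj), smul_zero]
    · simp
  have hr : ∀ i, x * p i = c i • p i := by
    intro i
    rw [hx, Finset.sum_mul, Finset.sum_eq_single i]
    · rw [smul_mul_assoc, hid]
    · intro j _ hj
      rw [smul_mul_assoc, horth j i hj, smul_zero]
    · simp
  have key : ∀ i j, p i * Δ x * p j = (c i - c j) • (p i * Δ (p i) * p j) := by
    intro i j
    obtain ⟨a, h1, h2⟩ := hΔ x (p i)
    have e1 : p i * Δ x * p j = (c j - c i) • (p i * a * p j) := by
      rw [h1]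
      calc p i * (a * x - x * a) * p j
          = p i * a * (x * p j) - (p i * x) * a * p j := by noncomm_ring
        _ = _ := by
          rw [hl, hr, mul_smul_comm, smul_mul_assoc, smul_mul_assoc, sub_smul]
    by_cases hij : i = j
    · subst hij
      rw [e1]; simp
    · have e2 : p i * Δ (p i) * p j = -(p i * a * p j) := by
        rw [h2]
        calc p i * (a * p i - p i * a) * p j
            = p i * a * (p i * p j) - (p i * p i) * a * p j := by noncomm_ring
          _ = _ := by rw [horth i j hij, hid]; simp
      rw [e1, e2, smul_neg, ← neg_smul, neg_sub]
  calc Δ x = (∑ i, p i) * Δ x * (∑ j, p j) := by rw [hsum]; simp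
    _ = ∑ i, ∑ j, p i * Δ x * p j := by
      rw [Finset.sum_mul, Finset.sum_mul_sum]
    _ = _ := by simp_rw [key]

/-- Completion of a family by the complement of its sum. -/
def auxCompl {A : Type*} [Ring A] {m : ℕ} (e : Fin m → A) : Option (Fin m) → A
  | none => 1 - ∑ i, e i
  | some i => e i

theorem auxCompl_sum {A : Type*} [Ring A] {m : ℕ} (e : Fin m → A) :
    ∑ i, auxCompl e i = 1 := by
  simp [Fintype.sum_option, auxCompl]

theorem auxCompl_mul {A : Type*} [Ring A] {m : ℕ} (e : Fin m → A)
    (hid : ∀ i, e i * e i = e i) (horth : ∀ i j, i ≠ j → e i * e j = 0) :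
    (∀ i, auxCompl e i * auxCompl e i = auxCompl e i) ∧
    (∀ i j, i ≠ j → auxCompl e i * auxCompl e j = 0) := by
  have hl : ∀ i, e i * ∑ j, e j = e i := by
    intro i
    rw [Finset.mul_sum, Finset.sum_eq_single i (fun j _ hj => horth i j hj.symm) (by simp), hid]
  have hr : ∀ i, (∑ j, e j) * e i = e i := by
    intro i
    rw [Finset.sum_mul, Finset.sum_eq_single i (fun j _ hj => horth j i hj) (by simp), hid]
  have hs : (∑ j, e j) * (∑ j, e j) = ∑ j, e j := by
    rw [Finset.sum_mul]; simp_rw [hl]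
  constructor
  · rintro (_ | i)
    · simp [auxCompl, mul_sub, sub_mul, hs]
    · exact hid i
  · rintro (_ | i) (_ | j) h
    · exact absurd rfl h
    · simp [auxCompl, sub_mul, hr]
    · simp [auxCompl, mul_sub, hl]
    · exact horth i j (fun hh => h (by rw [hh]))

theorem auxCompl_comm {A : Type*} [Ring A] {m k : ℕ} (e : Fin m → A) (f : Fin k → A)
    (hcomm : ∀ i j, e i * f j = f j * e i) (i : Option (Fin m)) (j : Option (Fin k)) :
    Commute (auxCompl e i) (auxCompl f j) := by
  have h : ∀ i j, Commute (e i) (f j) := hcomm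
  have h1 : ∀ i, Commute (e i) (auxCompl f j) := by
    intro i
    rcases j with _ | j
    · exact (Commute.one_right _).sub_right (Commute.sum_right _ _ _ fun j _ => h i j)
    · exact h i j
  rcases i with _ | i
  · exact (Commute.one_left _).sub_left (Commute.sum_left _ _ _ fun i _ => h1 i)
  · exact h1 i

theorem twoLocalInner_additive_on_commuting_projection_combinations
    {A : Type*} [Ring A] [Algebra ℂ A] [StarRing A] (Δ : A → A)
    (hΔ : ∀ x y : A, ∃ a : A, Δ x = a * x - x * a ∧ Δ y = a * y - y * a)
    (m k : ℕ) (e : Fin m → A) (f : Fin k → A)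
    (heproj : ∀ i, IsIdempotentElem (e i) ∧ star (e i) = e i)
    (hfproj : ∀ j, IsIdempotentElem (f j) ∧ star (f j) = f j)
    (heorth : ∀ i i', i ≠ i' → e i * e i' = 0)
    (hforth : ∀ j j', j ≠ j' → f j * f j' = 0)
    (hcomm : ∀ i j, e i * f j = f j * e i)
    (lam : Fin m → ℂ) (mu : Fin k → ℂ) :
    Δ ((∑ i, lam i • e i) + ∑ j, mu j • f j)
      = Δ (∑ i, lam i • e i) + Δ (∑ j, mu j • f j) := by
  obtain ⟨hE, hEo⟩ := auxCompl_mul e (fun i => (heproj i).1) heorth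
  obtain ⟨hF, hFo⟩ := auxCompl_mul f (fun i => (hfproj i).1) hforth
  have hC := auxCompl_comm e f hcomm
  have hEs := auxCompl_sum e
  have hFs := auxCompl_sum f
  have hx : ∑ i, lam i • e i = ∑ i, (i.elim 0 lam : ℂ) • auxCompl e i := by
    simp [Fintype.sum_option, auxCompl]
  have hy : ∑ i, mu i • f i = ∑ i, (i.elim 0 mu : ℂ) • auxCompl f i := by
    simp [Fintype.sum_option, auxCompl]
  rw [hx, hy]
  generalize auxCompl e = E at *
  generalize auxCompl f = F at *
  have form := aux_formula Δ hΔ (fun q : Option (Fin m) × Option (Fin k) => E q.1 * F q.2)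
    (by
      rintro ⟨i, j⟩
      change E i * F j * (E i * F j) = E i * F j
      rw [(hC i j).symm.mul_mul_mul_comm, hE, hF])
    (by
      rintro ⟨i, j⟩ ⟨i', j'⟩ h
      change E i * F j * (E i' * F j') = 0
      rw [(hC i' j).symm.mul_mul_mul_comm]
      by_cases hi : i = i'
      · have hj : j ≠ j' := fun hj => h (by rw [hi, hj])
        rw [hFo j j' hj, mul_zero]
      · rw [hEo i i' hi, zero_mul])
    (by rw [Fintype.sum_prod_type, ← Finset.sum_mul_sum, hEs, hFs, one_mul])
  have hx' : ∑ i, (i.elim 0 lam : ℂ) • E i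
      = ∑ q : Option (Fin m) × Option (Fin k), (q.1.elim 0 lam : ℂ) • (E q.1 * F q.2) := by
    rw [Fintype.sum_prod_type]
    refine Finset.sum_congr rfl fun i _ => ?_
    dsimp only
    rw [← Finset.smul_sum, ← Finset.mul_sum, hFs, mul_one]
  have hy' : ∑ i, (i.elim 0 mu : ℂ) • F i
      = ∑ q : Option (Fin m) × Option (Fin k), (q.2.elim 0 mu : ℂ) • (E q.1 * F q.2) := by
    rw [Fintype.sum_prod_type_right]
    refine Finset.sum_congr rfl fun j _ => ?_
    dsimp only
    rw [← Finset.smul_sum, ← Finset.sum_mul, hEs, one_mul]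
  rw [hx', hy', ← Finset.sum_add_distrib]
  simp_rw [← add_smul]
  rw [form (fun q => q.1.elim 0 lam + q.2.elim 0 mu), form (fun q => q.1.elim 0 lam),
    form (fun q => q.2.elim 0 mu)]
  simp_rw [← Finset.sum_add_distrib, ← add_smul]
  refine Finset.sum_congr rfl fun q _ => Finset.sum_congr rfl fun r _ => ?_
  congr 1
  ring
end

section
/- Let A = C(X, B(H)) be the C*-algebra of continuous functions from a compact Hausdorff totally disconnected space X to B(H). Then the linear span of projections of A is norm-dense in A, provided X is extremally disconnected (Stonean). -/
section helpers

variable {H : Type*} [NormedAddCommGroup H] [InnerProductSpace ℂ H] [CompleteSpace H]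

/-- One-step approximation of a self-adjoint operator by a multiple of a symmetry `2p - 1`. -/
lemma exists_proj_step (a : H →L[ℂ] H) (ha : IsSelfAdjoint a) (c : ℝ) (hc : ‖a‖ ≤ c) :
    ∃ p : H →L[ℂ] H, IsIdempotentElem p ∧ star p = p ∧
      ‖a - ((c / 2 : ℝ) : ℂ) • ((2 : ℂ) • p - 1)‖ ≤ c / 2 := by
  have hc0 : 0 ≤ c := (norm_nonneg a).trans hc
  have : CompleteSpace (LinearMap.ker (a⁻ : H →L[ℂ] H).toLinearMap) :=
    (ContinuousLinearMap.isClosed_ker (a⁻ : H →L[ℂ] H)).completeSpace_coe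
  let K : Submodule ℂ H := LinearMap.ker (a⁻ : H →L[ℂ] H).toLinearMap
  have : K.HasOrthogonalProjection := Submodule.HasOrthogonalProjection.ofCompleteSpace K
  let p := K.starProjection
  have hpi : IsIdempotentElem p := K.isIdempotentElem_starProjection
  have hps : star p = p := (isSelfAdjoint_starProjection K).star_eq
  have h1 : p * a⁺ = a⁺ := by
    ext v
    refine Submodule.starProjection_eq_self_iff.2 ?_
    change (a⁻ * a⁺) v = 0
    rw [CFC.negPart_mul_posPart]; rfl
  have h2 : a⁻ * p = 0 := by
    ext v
    exact K.starProjection_apply_mem v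
  have h3 : p * a⁻ = 0 := by
    have := congrArg star h2
    rwa [star_mul, hps, (IsSelfAdjoint.of_nonneg (CFC.negPart_nonneg a)).star_eq, star_zero] at this
  refine ⟨p, hpi, hps, ?_⟩
  set u : H →L[ℂ] H := (2 : ℂ) • p - 1 with hu
  have hua : u * a = CFC.abs a := by
    rw [← CFC.posPart_add_negPart a ha]
    conv_lhs => rw [← CFC.posPart_sub_negPart a ha]
    rw [hu, sub_mul, smul_mul_assoc, mul_sub, h1, h3, one_mul, two_smul]
    abel
  have huu : u * u = 1 := by
    have : p * p = p := hpi
    rw [hu, sub_mul, mul_sub, mul_sub, smul_mul_assoc, mul_smul_comm, this, one_mul, mul_one,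
      one_mul, two_smul, two_smul]
    abel
  have hun : ‖u‖ ≤ 1 := by
    refine ContinuousLinearMap.opNorm_le_bound _ zero_le_one fun x => ?_
    have : u x = K.reflection x := by
      rw [Submodule.reflection_apply, hu]
      simp [p, two_smul]
    rw [this, LinearIsometryEquiv.norm_map, one_mul]
  have hb : CFC.abs a - ((c / 2 : ℝ) : ℂ) • (1 : H →L[ℂ] H)
      = cfc (fun x : ℝ => ‖x‖ - c / 2) a := by
    rw [cfc_sub (fun x : ℝ => ‖x‖) (fun _ => c / 2) a, ← CFC.abs_eq_cfc_norm a ha,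
      cfc_const (c / 2) a, Algebra.algebraMap_eq_smul_one]
    rfl
  have hbn : ‖CFC.abs a - ((c / 2 : ℝ) : ℂ) • (1 : H →L[ℂ] H)‖ ≤ c / 2 := by
    rw [hb]
    refine norm_cfc_le (by positivity) fun x hx => ?_
    have hx' : ‖x‖ ≤ c := by
      rcases subsingleton_or_nontrivial H with h | h
      · have : spectrum ℝ a = ∅ := by
          have : Subsingleton (H →L[ℂ] H) := inferInstance
          exact spectrum.of_subsingleton a
        simp [this] at hx
      · exact (spectrum.norm_le_norm_of_mem hx).trans hc
    rw [Real.norm_eq_abs, abs_le]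
    constructor <;> linarith [norm_nonneg x]
  have key : a - ((c / 2 : ℝ) : ℂ) • u
      = u * (CFC.abs a - ((c / 2 : ℝ) : ℂ) • (1 : H →L[ℂ] H)) := by
    rw [← hua, mul_sub, ← mul_assoc, huu, one_mul, mul_smul_comm, mul_one]
  rw [key]
  calc _ ≤ ‖u‖ * ‖CFC.abs a - ((c / 2 : ℝ) : ℂ) • (1 : H →L[ℂ] H)‖ := norm_mul_le _ _
    _ ≤ 1 * (c / 2) := by gcongr
    _ = c / 2 := one_mul _

lemma exists_span_approx (n : ℕ) : ∀ (a : H →L[ℂ] H) (_ : IsSelfAdjoint a) (c : ℝ) (_ : ‖a‖ ≤ c),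
    ∃ s ∈ Submodule.span ℂ {p : H →L[ℂ] H | IsIdempotentElem p ∧ star p = p},
      ‖a - s‖ ≤ c / 2 ^ n := by
  induction n with
  | zero => intro a _ c hc; exact ⟨0, Submodule.zero_mem _, by simpa using hc⟩
  | succ n ih =>
    intro a ha c hc
    obtain ⟨p, hp, hp', hn⟩ := exists_proj_step a ha c hc
    have hsa : IsSelfAdjoint (a - ((c / 2 : ℝ) : ℂ) • ((2 : ℂ) • p - 1)) := by
      rw [IsSelfAdjoint, star_sub, star_smul, star_sub, star_smul, hp', ha.star_eq, star_one]
      simp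
    obtain ⟨s, hs, hsn⟩ := ih _ hsa _ hn
    refine ⟨((c / 2 : ℝ) : ℂ) • ((2 : ℂ) • p - 1) + s, ?_, ?_⟩
    · refine Submodule.add_mem _ (Submodule.smul_mem _ _ (Submodule.sub_mem _
        (Submodule.smul_mem _ _ (Submodule.subset_span ⟨hp, hp'⟩)) (Submodule.subset_span ?_))) hs
      exact ⟨IsIdempotentElem.one, star_one _⟩
    · rw [← sub_sub]
      refine hsn.trans_eq ?_
      rw [pow_succ]; field_simp

/-- Every bounded operator is a norm limit of linear combinations of projections. -/
lemma span_proj_closure_eq_top :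
    (Submodule.span ℂ {p : H →L[ℂ] H | IsIdempotentElem p ∧ star p = p}).topologicalClosure
      = ⊤ := by
  have hsa : ∀ a : H →L[ℂ] H, IsSelfAdjoint a → a ∈
      (Submodule.span ℂ {p : H →L[ℂ] H | IsIdempotentElem p ∧ star p = p}).topologicalClosure := by
    intro a ha
    change a ∈ closure _
    rw [Metric.mem_closure_iff]
    intro ε hε
    have ht : Filter.Tendsto (fun n : ℕ => ‖a‖ / 2 ^ n) Filter.atTop (nhds 0) :=
      tendsto_const_nhds.div_atTop (tendsto_pow_atTop_atTop_of_one_lt one_lt_two)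
    obtain ⟨n, hn⟩ := (ht.eventually (gt_mem_nhds hε)).exists
    obtain ⟨s, hs, hsn⟩ := exists_span_approx n a ha ‖a‖ le_rfl
    exact ⟨s, hs, by rw [dist_eq_norm]; exact hsn.trans_lt hn⟩
  rw [eq_top_iff, ← CStarAlgebra.span_nonneg (A := H →L[ℂ] H), Submodule.span_le]
  exact fun a ha => hsa a (IsSelfAdjoint.of_nonneg ha)

end helpers

theorem span_projections_dense_in_continuous_functions
    {X : Type*} [TopologicalSpace X] [CompactSpace X] [T2Space X]
    [TotallyDisconnectedSpace X] [ExtremallyDisconnected X]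
    {H : Type*} [NormedAddCommGroup H] [InnerProductSpace ℂ H] [CompleteSpace H] :
    Dense (↑(Submodule.span ℂ
      {p : C(X, H →L[ℂ] H) | IsIdempotentElem p ∧ star p = p}) :
        Set C(X, H →L[ℂ] H)) := by
  set S := Submodule.span ℂ {p : C(X, H →L[ℂ] H) | IsIdempotentElem p ∧ star p = p} with hS
  -- the indicator embedding of a clopen set
  have hcont : ∀ (U : TopologicalSpace.Clopens X) (T : H →L[ℂ] H),
      Continuous ((U : Set X).indicator fun _ => T) := fun U T =>
    continuous_const.indicator (by simp [U.isClopen.frontier_eq])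
  let L : TopologicalSpace.Clopens X → ((H →L[ℂ] H) →L[ℂ] C(X, H →L[ℂ] H)) := fun U =>
    LinearMap.mkContinuous
      { toFun := fun T => ⟨(U : Set X).indicator fun _ => T, hcont U T⟩
        map_add' := fun T T' => by
          ext1 x
          by_cases hx : x ∈ (U : Set X) <;> simp [hx]
        map_smul' := fun r T => by
          ext1 x
          by_cases hx : x ∈ (U : Set X) <;> simp [hx] } 1 fun T => by
        rw [one_mul, ContinuousMap.norm_le _ (norm_nonneg T)]
        intro x
        exact norm_indicator_le_norm_self (fun _ => T) x
  have hL : ∀ U T x, L U T x = (U : Set X).indicator (fun _ => T) x := fun U T x => rfl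
  have hmem : ∀ U T, L U T ∈ S.topologicalClosure := by
    intro U T
    have hle : (Submodule.span ℂ
        {p : H →L[ℂ] H | IsIdempotentElem p ∧ star p = p}).topologicalClosure
        ≤ S.topologicalClosure.comap (L U).toLinearMap := by
      refine Submodule.topologicalClosure_minimal _ ?_ ?_
      · rw [Submodule.span_le]
        rintro p ⟨hp, hp'⟩
        refine S.le_topologicalClosure (Submodule.subset_span ⟨?_, ?_⟩)
        · ext1 x
          change L U p x * L U p x = L U p x
          rw [hL]
          by_cases hx : x ∈ (U : Set X)
          · simpa [hx] using hp.eq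
          · simp [hx]
        · ext1 x
          change star (L U p x) = L U p x
          rw [hL]
          by_cases hx : x ∈ (U : Set X)
          · simpa [hx] using hp'
          · simp [hx]
      · exact S.isClosed_topologicalClosure.preimage (L U).continuous
    rw [span_proj_closure_eq_top] at hle
    exact hle (Submodule.mem_top (x := T))
  intro f
  rw [← closure_closure, Metric.mem_closure_iff]
  intro ε hε
  have hD : {q : (H →L[ℂ] H) × (H →L[ℂ] H) | dist q.1 q.2 < ε / 2} ∈
      nhdsSet (Set.diagonal (H →L[ℂ] H)) := by
    rw [mem_nhdsSet_iff_forall]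
    rintro ⟨x, y⟩ (rfl : x = y)
    refine (isOpen_lt (by fun_prop) continuous_const).mem_nhds ?_
    simpa using hε
  obtain ⟨n, U, v, h⟩ :=
    f.exists_finite_sum_const_indicator_approximation_of_mem_nhds_diagonal hD
  refine ⟨∑ i, L (U i) (v i), S.topologicalClosure.sum_mem fun i _ => hmem _ _, ?_⟩
  refine lt_of_le_of_lt ?_ (half_lt_self hε)
  rw [ContinuousMap.dist_le (by positivity)]
  intro x
  rw [ContinuousMap.sum_apply]
  exact (h x).le
end
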